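/- arXiv:gr-qc/0108005 — 4 statements merged into one kernel-verified Lean document; each statement's English description precedes it below -/
import Mathlib

section
/- Let a ∈ ℝ and let U : (a,∞) → ℝ be twice differentiable with U''(t) = U(t)² and U(t) ≠ 0 for all t, and suppose U'(t) → c as t → +∞ for some real c ≤ 0. Then U'(t) < 0 for every t ∈ (a,∞), and consequently (20/3)·U(t)⁴/U'(t) < 0 for every t ∈ (a,∞); in particular (20/3)·U(t)⁴/U'(t) does not tend to +∞ as t → +∞. -/
open Filter Set

/-- **Case (a) of the `A > 0` Wyman analysis.** If `U : (a,∞) → ℝ` is twice differentiable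
with `U'' = U²` and `U ≠ 0`, and `U'(t) → c` as `t → +∞` for some `c ≤ 0`, then `U' < 0`
everywhere on `(a,∞)`, hence `(20/3)·U⁴/U' < 0` everywhere; in particular
`(20/3)·U⁴/U'` does not tend to `+∞` as `t → +∞`. -/
theorem wyman_A_pos_case_a
    (a c : ℝ) (hc : c ≤ 0)
    (U U' U'' : ℝ → ℝ)
    (hU : ∀ t ∈ Ioi a, HasDerivAt U (U' t) t)
    (hU' : ∀ t ∈ Ioi a, HasDerivAt U' (U'' t) t)
    (hfield : ∀ t ∈ Ioi a, U'' t = (U t) ^ 2)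
    (hne : ∀ t ∈ Ioi a, U t ≠ 0)
    (hlim : Tendsto U' atTop (nhds c)) :
    (∀ t ∈ Ioi a, U' t < 0 ∧ (20 / 3) * (U t) ^ 4 / U' t < 0) ∧
      ¬ Tendsto (fun t => (20 / 3) * (U t) ^ 4 / U' t) atTop atTop := by
  have hmono : StrictMonoOn U' (Ioi a) := by
    apply strictMonoOn_of_deriv_pos (convex_Ioi a)
    · intro t ht
      exact (hU' t ht).continuousAt.continuousWithinAt
    · intro t ht
      rw [interior_Ioi] at ht
      rw [(hU' t ht).deriv, hfield t ht]
      have := hne t ht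
      positivity
  have hneg : ∀ t ∈ Ioi a, U' t < 0 := by
    intro t ht
    have ht' : a < t := ht
    have h1 : t + 1 ∈ Ioi a := by
      show a < t + 1
      linarith
    have h2 : U' t < U' (t + 1) := hmono ht h1 (by linarith)
    have h3 : U' (t + 1) ≤ c := by
      apply ge_of_tendsto hlim
      filter_upwards [eventually_ge_atTop (t + 1)] with s hs
      have h4 : s ∈ Ioi a := by
        show a < s
        linarith
      exact hmono.monotoneOn h1 h4 hs
    linarith
  have hq : ∀ t ∈ Ioi a, (20 / 3) * (U t) ^ 4 / U' t < 0 := by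
    intro t ht
    have := hne t ht
    exact div_neg_of_pos_of_neg (by positivity) (hneg t ht)
  refine ⟨fun t ht => ⟨hneg t ht, hq t ht⟩, fun h => ?_⟩
  obtain ⟨t, h1, h2⟩ := ((h.eventually_ge_atTop 0).and (eventually_gt_atTop a)).exists
  exact absurd (hq t h2) (not_lt.mpr h1)
end

section
/- Let A ∈ ℝ, a ∈ ℝ, and let U : (a,∞) → ℝ be differentiable with U'(t)² = (2/3)U(t)³ − (1/4)A for all t, and suppose U'(t) → β as t → +∞ for some real β. Then U(t)³ → (3/2)(β² + (1/4)A) as t → +∞, hence U(t) → s where s is the real cube root of (3/2)(β² + (1/4)A). If moreover β > 0, then (20/3)·U(t)⁴/U'(t) → (20/3)·s⁴/β as t → +∞; in particular (20/3)·U(t)⁴/U'(t) tends to a finite limit and does not tend to +∞. -/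
open Filter Set

/-- **Case (b) of the `A > 0` Wyman analysis.** If `U : (a,∞) → ℝ` is differentiable,
satisfies the Wyman constraint `U'² = (2/3)U³ - (1/4)A`, and `U'(t) → β` as `t → +∞`,
then `U³ → (3/2)(β² + (1/4)A)`, hence `U → s` where `s` is the real cube root of
`(3/2)(β² + (1/4)A)`.  If moreover `β > 0`, then `(20/3)·U⁴/U' → (20/3)·s⁴/β`; in
particular `(20/3)·U⁴/U'` tends to a finite limit and does not tend to `+∞`. -/
theorem wyman_A_pos_case_b
    (A a β : ℝ)
    (U U' : ℝ → ℝ)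
    (hU : ∀ t ∈ Ioi a, HasDerivAt U (U' t) t)
    (hconstraint : ∀ t ∈ Ioi a, (U' t) ^ 2 = (2 / 3) * (U t) ^ 3 - (1 / 4) * A)
    (hlim : Tendsto U' atTop (nhds β)) :
    Tendsto (fun t => (U t) ^ 3) atTop (nhds ((3 / 2) * (β ^ 2 + (1 / 4) * A))) ∧
      ∀ s : ℝ, s ^ 3 = (3 / 2) * (β ^ 2 + (1 / 4) * A) →
        Tendsto U atTop (nhds s) ∧
          (0 < β →
            Tendsto (fun t => (20 / 3) * (U t) ^ 4 / U' t) atTop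
                (nhds ((20 / 3) * s ^ 4 / β)) ∧
              ¬ Tendsto (fun t => (20 / 3) * (U t) ^ 4 / U' t) atTop atTop) := by
  have h3 : Tendsto (fun t => (U t) ^ 3) atTop
      (nhds ((3 / 2) * (β ^ 2 + (1 / 4) * A))) := by
    have h := ((hlim.pow 2).add_const ((1 / 4) * A)).const_mul (3 / 2 : ℝ)
    refine h.congr' ?_
    filter_upwards [Ioi_mem_atTop a] with t ht
    rw [hconstraint t ht]
    ring
  refine ⟨h3, fun s hs => ?_⟩
  have hmono : StrictMono (fun x : ℝ => x ^ 3) := Odd.strictMono_pow (by decide)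
  rw [← hs] at h3
  have hUs : Tendsto U atTop (nhds s) := by
    rw [tendsto_order] at h3 ⊢
    refine ⟨fun b hb => ?_, fun b hb => ?_⟩
    · filter_upwards [h3.1 (b ^ 3) (hmono hb)] with t ht
      exact hmono.lt_iff_lt.1 ht
    · filter_upwards [h3.2 (b ^ 3) (hmono hb)] with t ht
      exact hmono.lt_iff_lt.1 ht
  refine ⟨hUs, fun hβ => ?_⟩
  have hq : Tendsto (fun t => (20 / 3) * (U t) ^ 4 / U' t) atTop
      (nhds ((20 / 3) * s ^ 4 / β)) :=
    ((hUs.pow 4).const_mul (20 / 3 : ℝ)).div hlim hβ.ne'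
  exact ⟨hq, not_tendsto_atTop_of_tendsto_nhds hq⟩
end

section
/- Let A < 0 and a ∈ ℝ. There is no differentiable function U : (−∞,a) → ℝ such that U'(t) > 0 and U'(t)² = (2/3)U(t)³ − (1/4)A for all t, and U'(t) → 0 as t → −∞. -/
open Filter Set

/-- **Case (c) of the `A < 0` Wyman analysis.**  For `A < 0` there is no differentiable
`U : (-∞,a) → ℝ` with `U' > 0` satisfying the Wyman constraint
`U'² = (2/3)U³ - (1/4)A` and with `U'(t) → 0` as `t → -∞`. -/
theorem wyman_A_neg_case_c
    (A a : ℝ) (hA : A < 0) :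
    ¬ ∃ U U' : ℝ → ℝ,
        (∀ t ∈ Iio a, HasDerivAt U (U' t) t) ∧
        (∀ t ∈ Iio a, 0 < U' t) ∧
        (∀ t ∈ Iio a, (U' t) ^ 2 = (2 / 3) * (U t) ^ 3 - (1 / 4) * A) ∧
        Tendsto U' atBot (nhds 0) := by
  rintro ⟨U, U', hd, hp, hc, ht⟩
  have hd2 : ∀ t ∈ Iio a, HasDerivAt U' ((U t) ^ 2) t := by
    intro t hta
    have hpos := hp t hta
    have h1 : HasDerivAt (fun s => (2 / 3) * (U s) ^ 3 - (1 / 4) * A)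
        (2 * U t ^ 2 * U' t) t := by
      have := (((hd t hta).pow 3).const_mul (2 / 3 : ℝ)).sub_const ((1 / 4) * A)
      refine this.congr_deriv ?_
      simp only [Nat.add_one_sub_one, Nat.cast_ofNat]
      ring
    have hne : (2 / 3) * (U t) ^ 3 - (1 / 4) * A ≠ 0 := by
      rw [← hc t hta]; positivity
    have h2 := h1.sqrt hne
    have h3 : 2 * U t ^ 2 * U' t / (2 * Real.sqrt ((2 / 3) * (U t) ^ 3 - (1 / 4) * A))
        = U t ^ 2 := by
      rw [← hc t hta, Real.sqrt_sq hpos.le]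
      field_simp
    rw [h3] at h2
    refine h2.congr_of_eventuallyEq ?_
    filter_upwards [Iio_mem_nhds hta] with s hs
    rw [← hc s hs, Real.sqrt_sq (hp s hs).le]
  have hsq : Tendsto (fun t => U' t ^ 2) atBot (nhds 0) := by
    simpa using ht.pow 2
  have hev : ∀ᶠ t in atBot, U' t ^ 2 < -A / 8 := hsq.eventually_lt_const (by linarith)
  obtain ⟨T0, hT0⟩ := eventually_atBot.1 hev
  obtain ⟨T, hTa, hTT⟩ : ∃ T, T < a ∧ T ≤ T0 :=
    ⟨min (a - 1) T0, lt_of_le_of_lt (min_le_left _ _) (by linarith), min_le_right _ _⟩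
  obtain ⟨c, hc0, hc1, hcm⟩ : ∃ c : ℝ, 0 < c ∧ c ≤ 1 ∧ c ≤ -A * 3 / 16 :=
    ⟨min 1 (-A * 3 / 16), lt_min one_pos (by linarith), min_le_left _ _, min_le_right _ _⟩
  have hU : ∀ t ≤ T, c ^ 2 ≤ U t ^ 2 := by
    intro t htT
    have e1 := hT0 t (htT.trans hTT)
    rw [hc t (lt_of_le_of_lt htT hTa)] at e1
    have e2 : U t ^ 3 < -c := by linarith
    have e3 : c ^ 3 ≤ c := by
      simpa using pow_le_pow_of_le_one hc0.le hc1 (show 1 ≤ 3 by norm_num)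
    have e4 : U t ≤ -c := by
      by_contra! h
      have := (Odd.strictMono_pow (R := ℝ) (n := 3) (by decide)) h
      simp only [] at this
      have e5 : (-c) ^ 3 = -c ^ 3 := by ring
      linarith
    nlinarith
  have hpT := hp T hTa
  have hc2 : 0 < c ^ 2 := by positivity
  have hdiv : 0 < U' T / c ^ 2 := by positivity
  set t := T - U' T / c ^ 2 - 1 with htdef
  have htT : t < T := by linarith
  obtain ⟨x, hx, hxe⟩ := exists_hasDerivAt_eq_slope U' (fun s => U s ^ 2) htT
    (fun s hs => (hd2 s (lt_of_le_of_lt hs.2 hTa)).continuousAt.continuousWithinAt)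
    (fun s hs => hd2 s (hs.2.trans hTa))
  have hxU := hU x hx.2.le
  rw [eq_div_iff (by linarith)] at hxe
  have h5 : c ^ 2 * (T - t) = U' T + c ^ 2 := by
    rw [htdef]; field_simp; ring
  have h6 := mul_le_mul_of_nonneg_right hxU (show 0 ≤ T - t by linarith)
  have h7 := hp t (htT.trans hTa)
  linarith
end

section
/- Let b > 0 and fix a ∈ (0,b). Let p : (0,b) → ℝ be continuous and suppose there is a constant K ≥ 0 such that |∫_T^a p(τ) dτ| ≤ K for all T ∈ (0,a]. Let y : [0,b) → ℝ be continuous on [0,b) and differentiable on (0,b), with y'(T) + p(T)·y(T) = 0 for all T ∈ (0,b), and y(0) = 0. Then y(T) = 0 for all T ∈ [0,b). -/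
open Filter Set

/-- **The ODE argument in the general proof of the Zero Acceleration Result.**
Let `b > 0`, `a ∈ (0,b)`, let `p : (0,b) → ℝ` be continuous with
`|∫_T^a p(τ) dτ| ≤ K` for all `T ∈ (0,a]`, and let `y` be continuous on `[0,b)` and
differentiable on `(0,b)` with `y' + p·y = 0` on `(0,b)` and `y(0) = 0`.
Then `y ≡ 0` on `[0,b)`. -/
theorem ode_zero_of_bounded_integral_coefficient
    (b a : ℝ) (hb : 0 < b) (ha : a ∈ Ioo 0 b)
    (p : ℝ → ℝ) (hp : ContinuousOn p (Ioo 0 b))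
    (K : ℝ) (hK : 0 ≤ K)
    (hint : ∀ T ∈ Ioc 0 a, |∫ τ in T..a, p τ| ≤ K)
    (y y' : ℝ → ℝ)
    (hycont : ContinuousOn y (Ico 0 b))
    (hyderiv : ∀ T ∈ Ioo 0 b, HasDerivAt y (y' T) T)
    (hode : ∀ T ∈ Ioo 0 b, y' T + p T * y T = 0)
    (hy0 : y 0 = 0) :
    ∀ T ∈ Ico 0 b, y T = 0 := by
  have hP : ∀ T ∈ Ioo 0 b, HasDerivAt (fun u => ∫ x in a..u, p x) (p T) T := by
    intro T hT
    apply intervalIntegral.integral_hasDerivAt_right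
    · apply ContinuousOn.intervalIntegrable
      exact hp.mono (ordConnected_Ioo.uIcc_subset ha hT)
    · exact hp.stronglyMeasurableAtFilter isOpen_Ioo T hT
    · exact hp.continuousAt (Ioo_mem_nhds hT.1 hT.2)
  have hg : ∀ T ∈ Ioo 0 b,
      HasDerivAt (fun u => y u * Real.exp (∫ x in a..u, p x)) 0 T := by
    intro T hT
    have h := (hyderiv T hT).mul (hP T hT).exp
    refine h.congr_deriv ?_
    linear_combination Real.exp (∫ x in a..T, p x) * hode T hT
  obtain ⟨c, hc⟩ := isOpen_Ioo.exists_is_const_of_deriv_eq_zero isPreconnected_Ioo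
    (fun T hT => (hg T hT).differentiableAt.differentiableWithinAt)
    (fun T hT => (hg T hT).deriv)
  have hle : ∀ T ∈ Ioo 0 a, |c| ≤ |y T| * Real.exp K := by
    intro T hT
    rw [← hc T ⟨hT.1, hT.2.trans ha.2⟩, abs_mul, Real.abs_exp]
    have h1 := hint T ⟨hT.1, hT.2.le⟩
    rw [intervalIntegral.integral_symm, abs_neg] at h1
    gcongr
    exact (le_abs_self _).trans h1
  have hlim : Tendsto (fun T => |y T| * Real.exp K) (nhdsWithin 0 (Ioo 0 a)) (nhds 0) := by
    have h := (hycont 0 ⟨le_rfl, hb⟩).mono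
      (fun x (hx : x ∈ Ioo 0 a) => (⟨hx.1.le, hx.2.trans ha.2⟩ : x ∈ Ico 0 b))
    have h2 := (h.tendsto.abs).mul_const (Real.exp K)
    simpa [hy0] using h2
  haveI : (nhdsWithin (0:ℝ) (Ioo 0 a)).NeBot := left_nhdsWithin_Ioo_neBot ha.1
  have hc0 : |c| ≤ 0 := ge_of_tendsto hlim (eventually_nhdsWithin_of_forall hle)
  have hc1 : c = 0 := abs_nonpos_iff.mp hc0
  intro T hT
  rcases hT.1.eq_or_lt with h | h
  · rw [← h, hy0]
  · have h3 := hc T ⟨h, hT.2⟩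
    rw [hc1] at h3
    exact (mul_eq_zero.mp h3).resolve_right (Real.exp_ne_zero _)
end
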